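/- arXiv:2303.10063 — 4 statements merged into one kernel-verified Lean document; each statement's English description precedes it below -/
import Mathlib

section
/- (Theorem 1) Suppose α > 0 and either n > 0 with κ ≠ 0, or κ = 0 with n ∈ ℝ arbitrary. Then F is a strictly increasing bijection of [0,∞) onto [0,∞) with inverse F^{−1}, and for every ε ∈ (0, ε₀] the regularized steady problem (1/(Y+ε)) d/dY[ (1 + κ^α |V'(Y)|^α)^{(n−1)/α} (Y+ε) V'(Y) ] = b(Y) on (0,R), V'(0) = 0, V(R) = 0, has a unique classical solution V^ε ∈ C²([0,R]), given explicitly by V^ε(Y) = −∫_Y^R F^{−1}(B_ε(s)) ds. Moreover 0 ≤ (V^ε)'(Y) ≤ F^{−1}(B_{ε₀}(Y)) ≤ F^{−1}(b₀(R+ε₀)/2) for every Y ∈ [0,R]. -/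
open Set Filter Real intervalIntegral

/-- The Carreau–Yasuda flux function `F(η) = (1 + κ^α |η|^α)^((n-1)/α) · η`. -/
noncomputable def Fcy (α κ n : ℝ) (η : ℝ) : ℝ :=
  (1 + κ ^ α * |η| ^ α) ^ ((n - 1) / α) * η

/-- The regularized averaged pressure gradient
`B_ε(Y) = (1/(Y+ε)) ∫₀^Y (s+ε) b(s) ds`. -/
noncomputable def Bf (b : ℝ → ℝ) (ε Y : ℝ) : ℝ :=
  (Y + ε)⁻¹ * ∫ s in (0:ℝ)..Y, (s + ε) * b s

/-- `V` solves the regularized steady problem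
`(1/(Y+ε)) d/dY[ (1+κ^α |V'|^α)^{(n-1)/α} (Y+ε) V' ] = b(Y)` on `(0,R)` with
`V'(0) = 0`, `V(R) = 0`, the derivatives being taken within `[0,R]`. -/
def IsSteadySol (α κ n R ε : ℝ) (b V : ℝ → ℝ) : Prop :=
  (∀ Y ∈ Ioo 0 R,
    HasDerivWithinAt
      (fun y => (1 + κ ^ α * |derivWithin V (Icc 0 R) y| ^ α) ^ ((n - 1) / α) *
        ((y + ε) * derivWithin V (Icc 0 R) y)) ((Y + ε) * b Y) (Icc 0 R) Y) ∧
  derivWithin V (Icc 0 R) 0 = 0 ∧ V R = 0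

theorem Fcy_neg (α κ n η : ℝ) : Fcy α κ n (-η) = -Fcy α κ n η := by
  simp [Fcy]

theorem hasDerivAt_Fcy {α κ : ℝ} (n : ℝ) (hα : 0 < α) (hκ : 0 ≤ κ) (η : ℝ) :
    HasDerivAt (Fcy α κ n)
      ((1 + κ ^ α * |η| ^ α) ^ ((n - 1) / α - 1) * (1 + n * (κ ^ α * |η| ^ α))) η := by
  have hc : 0 ≤ κ ^ α := rpow_nonneg hκ α
  have hpos : ∀ x : ℝ, 0 < 1 + κ ^ α * |x| ^ α := fun x => by positivity
  rcases eq_or_ne η 0 with rfl | hη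
  · have hcont : ContinuousAt (fun x : ℝ => (1 + κ ^ α * |x| ^ α) ^ ((n - 1) / α)) 0 :=
      ((continuous_const.add (continuous_const.mul
        (continuous_abs.rpow_const fun _ => Or.inr hα.le))).rpow_const
          fun x => Or.inl (hpos x).ne').continuousAt
    rw [hasDerivAt_iff_tendsto_slope]
    have h := hcont.tendsto.mono_left (nhdsWithin_le_nhds (s := {(0 : ℝ)}ᶜ))
    simp only [abs_zero, zero_rpow hα.ne', mul_zero, add_zero, one_rpow, mul_one] at h ⊢
    refine h.congr' ?_
    filter_upwards [self_mem_nhdsWithin] with x hx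
    have hx' : x ≠ 0 := hx
    simp [slope_def_field, Fcy, hx']
  · have habs : |η| ≠ 0 := abs_ne_zero.mpr hη
    have h1 : HasDerivAt (fun x : ℝ => |x|) (SignType.sign η : ℝ) η := hasDerivAt_abs hη
    have h2 := ((h1.rpow_const (p := α) (Or.inl habs)).const_mul (κ ^ α)).const_add 1
    have h3 := (h2.rpow_const (p := (n - 1) / α) (Or.inl (hpos η).ne')).mul (hasDerivAt_id η)
    refine h3.congr_deriv ?_
    have hs : (SignType.sign η : ℝ) * η = |η| := sign_mul_self η
    have e1 : |η| ^ (α - 1) * |η| = |η| ^ α := by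
      rw [rpow_sub_one habs]; field_simp
    have e2 : (1 + κ ^ α * |η| ^ α) ^ ((n - 1) / α) =
        (1 + κ ^ α * |η| ^ α) ^ ((n - 1) / α - 1) * (1 + κ ^ α * |η| ^ α) := by
      rw [rpow_sub_one (hpos η).ne']; field_simp [(hpos η).ne']
    simp only [id, mul_one]
    rw [e2]
    have e3 : κ ^ α * ((SignType.sign η : ℝ) * α * |η| ^ (α - 1)) * ((n - 1) / α) * η
        = (n - 1) * (κ ^ α * |η| ^ α) := by
      rw [← e1, ← hs]; field_simp
    linear_combination (1 + κ ^ α * |η| ^ α) ^ ((n - 1) / α - 1) * e3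

theorem deriv_Fcy_pos {α κ n : ℝ} (hα : 0 < α) (hκ : 0 ≤ κ)
    (hcase : (0 < n ∧ κ ≠ 0) ∨ κ = 0) (η : ℝ) :
    0 < (1 + κ ^ α * |η| ^ α) ^ ((n - 1) / α - 1) * (1 + n * (κ ^ α * |η| ^ α)) := by
  have hc : 0 ≤ κ ^ α := rpow_nonneg hκ α
  rcases hcase with ⟨hn, -⟩ | rfl
  · positivity
  · simp [zero_rpow hα.ne']

theorem continuous_deriv_Fcy {α κ : ℝ} (n : ℝ) (hα : 0 < α) (hκ : 0 ≤ κ) :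
    Continuous fun η : ℝ =>
      (1 + κ ^ α * |η| ^ α) ^ ((n - 1) / α - 1) * (1 + n * (κ ^ α * |η| ^ α)) := by
  have hc : 0 ≤ κ ^ α := rpow_nonneg hκ α
  have h : Continuous fun η : ℝ => κ ^ α * |η| ^ α :=
    continuous_const.mul (continuous_abs.rpow_const fun _ => Or.inr hα.le)
  refine ((continuous_const.add h).rpow_const fun x => Or.inl ?_).mul
    (continuous_const.add (continuous_const.mul h))
  have : 0 < 1 + κ ^ α * |x| ^ α := by positivity
  exact this.ne'

theorem strictMono_Fcy {α κ n : ℝ} (hα : 0 < α) (hκ : 0 ≤ κ)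
    (hcase : (0 < n ∧ κ ≠ 0) ∨ κ = 0) : StrictMono (Fcy α κ n) :=
  strictMono_of_deriv_pos fun η => by
    rw [(hasDerivAt_Fcy n hα hκ η).deriv]
    exact deriv_Fcy_pos hα hκ hcase η

theorem tendsto_Fcy_atTop {α κ n : ℝ} (hα : 0 < α) (hκ : 0 ≤ κ)
    (hcase : (0 < n ∧ κ ≠ 0) ∨ κ = 0) : Tendsto (Fcy α κ n) atTop atTop := by
  have hc : 0 ≤ κ ^ α := rpow_nonneg hκ α
  rcases hcase with ⟨hn, -⟩ | rfl
  · rcases le_or_gt 1 n with h1 | h1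
    · refine tendsto_atTop_mono' _ ?_ tendsto_id
      filter_upwards [eventually_ge_atTop (0 : ℝ)] with x hx
      have : 1 ≤ (1 + κ ^ α * |x| ^ α) ^ ((n - 1) / α) :=
        one_le_rpow (le_add_of_nonneg_right (by positivity))
          (div_nonneg (by linarith) hα.le)
      exact le_mul_of_one_le_left hx this
    · have ht : Tendsto (fun x : ℝ => (1 + κ ^ α) ^ ((n - 1) / α) * x ^ n) atTop atTop :=
        (tendsto_rpow_atTop hn).const_mul_atTop (by positivity)
      refine tendsto_atTop_mono' _ ?_ ht
      filter_upwards [eventually_ge_atTop (1 : ℝ)] with x hx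
      have hx0 : 0 < x := by linarith
      have hle : 1 + κ ^ α * x ^ α ≤ (1 + κ ^ α) * x ^ α := by
        have := one_le_rpow hx hα.le
        linarith
      have h2 := rpow_le_rpow_of_nonpos (by positivity) hle
        (div_nonpos_of_nonpos_of_nonneg (by linarith : n - 1 ≤ 0) hα.le)
      rw [mul_rpow (by positivity) (by positivity), ← rpow_mul hx0.le,
        mul_div_cancel₀ _ hα.ne'] at h2
      have h3 := mul_le_mul_of_nonneg_right h2 hx0.le
      rw [mul_assoc, rpow_sub_one hx0.ne', div_mul_cancel₀ _ hx0.ne'] at h3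
      simpa [Fcy, abs_of_pos hx0] using h3
  · refine tendsto_id.congr fun x => ?_
    simp [Fcy, zero_rpow hα.ne']

theorem surjective_Fcy {α κ n : ℝ} (hα : 0 < α) (hκ : 0 ≤ κ)
    (hcase : (0 < n ∧ κ ≠ 0) ∨ κ = 0) : Function.Surjective (Fcy α κ n) := by
  have htop := tendsto_Fcy_atTop hα hκ hcase
  have hcont : Continuous (Fcy α κ n) :=
    continuous_iff_continuousAt.mpr fun η => (hasDerivAt_Fcy n hα hκ η).continuousAt
  refine hcont.surjective htop ?_
  refine (tendsto_neg_atTop_atBot.comp (htop.comp tendsto_neg_atBot_atTop)).congr fun x => ?_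
  simp [Fcy_neg]

/-- The flux function is a `C¹` increasing diffeomorphism of the line. -/
theorem exists_inverse_Fcy {α κ n : ℝ} (hα : 0 < α) (hκ : 0 ≤ κ)
    (hcase : (0 < n ∧ κ ≠ 0) ∨ κ = 0) :
    ∃ G : ℝ → ℝ, Function.LeftInverse G (Fcy α κ n) ∧ Function.RightInverse G (Fcy α κ n) ∧
      StrictMono G ∧ ContDiff ℝ 1 G := by
  let e := (strictMono_Fcy hα hκ hcase).orderIsoOfSurjective _ (surjective_Fcy hα hκ hcase)
  have hr : Function.RightInverse e.symm (Fcy α κ n) := fun x => e.apply_symm_apply x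
  have hcont : Continuous e.symm := e.symm.continuous
  have hd : ∀ x, HasDerivAt e.symm _ x := fun x =>
    (hasDerivAt_Fcy n hα hκ (e.symm x)).of_local_left_inverse hcont.continuousAt
      (deriv_Fcy_pos hα hκ hcase (e.symm x)).ne' (Eventually.of_forall hr)
  refine ⟨e.symm, fun x => e.symm_apply_apply x, hr, e.symm.strictMono, ?_⟩
  rw [contDiff_one_iff_deriv]
  refine ⟨fun x => (hd x).differentiableAt, ?_⟩
  rw [funext fun x => (hd x).deriv]
  exact ((continuous_deriv_Fcy n hα hκ).comp hcont).inv₀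
    fun x => (deriv_Fcy_pos hα hκ hcase (e.symm x)).ne'

theorem Bf_congr {b b' : ℝ → ℝ} {R Y : ℝ} (ε : ℝ) (h : EqOn b b' (Icc 0 R))
    (hY : Y ∈ Icc 0 R) : Bf b ε Y = Bf b' ε Y := by
  unfold Bf
  congr 1
  refine integral_congr fun s hs => ?_
  rw [uIcc_of_le hY.1] at hs
  simp only [h ⟨hs.1, hs.2.trans hY.2⟩]

theorem Bf_zero (b : ℝ → ℝ) (ε : ℝ) : Bf b ε 0 = 0 := by simp [Bf]

theorem add_mul_Bf (b : ℝ → ℝ) {ε Y : ℝ} (h : Y + ε ≠ 0) :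
    (Y + ε) * Bf b ε Y = ∫ s in (0 : ℝ)..Y, (s + ε) * b s := by
  rw [Bf, mul_inv_cancel_left₀ h]

theorem hasDerivAt_integral_weight {b : ℝ → ℝ} (hb : Continuous b) (ε Y : ℝ) :
    HasDerivAt (fun y => ∫ s in (0 : ℝ)..y, (s + ε) * b s) ((Y + ε) * b Y) Y := by
  have hc : Continuous fun s => (s + ε) * b s := by fun_prop
  exact integral_hasDerivAt_right (hc.intervalIntegrable _ _)
    hc.stronglyMeasurable.stronglyMeasurableAtFilter hc.continuousAt

theorem contDiff_integral_weight {b : ℝ → ℝ} (hb : Continuous b) (ε : ℝ) :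
    ContDiff ℝ 1 fun y => ∫ s in (0 : ℝ)..y, (s + ε) * b s := by
  rw [contDiff_one_iff_deriv]
  refine ⟨fun x => (hasDerivAt_integral_weight hb ε x).differentiableAt, ?_⟩
  rw [funext fun x => (hasDerivAt_integral_weight hb ε x).deriv]
  fun_prop

theorem contDiffOn_Bf {b : ℝ → ℝ} (hb : Continuous b) {ε : ℝ} (hε : 0 < ε) (R : ℝ) :
    ContDiffOn ℝ 1 (Bf b ε) (Icc 0 R) :=
  ((contDiff_id.add contDiff_const).contDiffOn.inv fun Y hY => by
    have := hY.1
    simp only [id]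
    positivity).mul (contDiff_integral_weight hb ε).contDiffOn

theorem Bf_nonneg {b : ℝ → ℝ} (hb : ∀ Y, 0 ≤ b Y) {ε Y : ℝ} (hε : 0 < ε) (hY : 0 ≤ Y) :
    0 ≤ Bf b ε Y :=
  mul_nonneg (by positivity) <| integral_nonneg hY fun s hs =>
    mul_nonneg (add_nonneg hs.1 hε.le) (hb s)

theorem Bf_mono {b : ℝ → ℝ} (hc : Continuous b) (hb : ∀ Y, 0 ≤ b Y) {ε δ Y : ℝ} (hε : 0 < ε)
    (hεδ : ε ≤ δ) (hY : 0 ≤ Y) : Bf b ε Y ≤ Bf b δ Y := by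
  have hδ : 0 < δ := hε.trans_le hεδ
  have hcont : ∀ γ : ℝ, Continuous fun s => (Y + γ)⁻¹ * ((s + γ) * b s) := fun γ => by fun_prop
  rw [Bf, Bf, ← integral_const_mul, ← integral_const_mul]
  refine integral_mono_on hY ((hcont ε).intervalIntegrable _ _)
    ((hcont δ).intervalIntegrable _ _) fun s hs => ?_
  rw [← mul_assoc, ← mul_assoc]
  refine mul_le_mul_of_nonneg_right ?_ (hb s)
  rw [inv_mul_eq_div, inv_mul_eq_div, div_le_div_iff₀ (by positivity) (by positivity)]
  nlinarith [hs.1, hs.2, mul_nonneg (sub_nonneg.mpr hs.2) (sub_nonneg.mpr hεδ)]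

theorem Bf_le {b : ℝ → ℝ} {b₀ : ℝ} (hc : Continuous b) (hb : ∀ Y, b Y ≤ b₀) (hb₀ : 0 ≤ b₀)
    {ε Y R : ℝ} (hε : 0 < ε) (hY : Y ∈ Icc 0 R) : Bf b ε Y ≤ b₀ * (R + ε) / 2 := by
  obtain ⟨h0, hR⟩ := hY
  have hpos : 0 < Y + ε := by positivity
  have h : ∫ s in (0 : ℝ)..Y, (s + ε) * b s ≤ ∫ s in (0 : ℝ)..Y, (s + ε) * b₀ := by
    have h1 : Continuous fun s => (s + ε) * b s := by fun_prop
    have h2 : Continuous fun s : ℝ => (s + ε) * b₀ := by fun_prop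
    exact integral_mono_on h0 (h1.intervalIntegrable _ _) (h2.intervalIntegrable _ _)
      fun s hs => mul_le_mul_of_nonneg_left (hb s) (add_nonneg hs.1 hε.le)
  have hi : ∫ s in (0 : ℝ)..Y, (s + ε) * b₀ = (Y ^ 2 / 2 + ε * Y) * b₀ := by
    rw [integral_mul_const, integral_add (by simp) (by simp)]
    simp only [integral_id, intervalIntegral.integral_const, smul_eq_mul]
    ring
  rw [hi] at h
  rw [Bf, inv_mul_le_iff₀ hpos]
  refine h.trans ?_
  nlinarith [mul_nonneg hb₀ (mul_nonneg hpos.le (sub_nonneg.mpr hR)), mul_nonneg hb₀ (sq_nonneg ε)]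

/-- The primitive of a continuous function on `[0,R]` that vanishes at `R`. -/
theorem hasDerivWithinAt_neg_integral {g : ℝ → ℝ} {R : ℝ} (hg : ContinuousOn g (Icc 0 R))
    {Y : ℝ} (hY : Y ∈ Icc 0 R) :
    HasDerivWithinAt (fun y => -∫ s in y..R, g s) (g Y) (Icc 0 R) Y := by
  have hR : 0 ≤ R := hY.1.trans hY.2
  have hc : Continuous (IccExtend hR ((Icc 0 R).domRestrict g)) :=
    (continuousOn_iff_continuous_domRestrict.mp hg).Icc_extend'
  have hEq : ∀ y ∈ Icc 0 R, IccExtend hR ((Icc 0 R).domRestrict g) y = g y := fun y hy =>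
    IccExtend_of_mem hR _ hy
  have h := (integral_hasDerivAt_left (hc.intervalIntegrable Y R)
    hc.stronglyMeasurable.stronglyMeasurableAtFilter hc.continuousAt).neg
  rw [neg_neg, hEq Y hY] at h
  refine h.hasDerivWithinAt.congr_of_mem (fun y hy => ?_) hY
  change _ = -_
  congr 1
  refine integral_congr fun s hs => ?_
  rw [uIcc_of_le hy.2] at hs
  exact (hEq s ⟨hy.1.trans hs.1, hs.2⟩).symm

theorem contDiffOn_two_of_hasDerivWithinAt {R : ℝ} (hR : 0 < R) {V g : ℝ → ℝ}
    (hV : ∀ Y ∈ Icc 0 R, HasDerivWithinAt V (g Y) (Icc 0 R) Y)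
    (hg : ContDiffOn ℝ 1 g (Icc 0 R)) : ContDiffOn ℝ 2 V (Icc 0 R) := by
  have hu := uniqueDiffOn_Icc hR
  rw [show (2 : WithTop ℕ∞) = 1 + 1 from one_add_one_eq_two.symm,
    contDiffOn_succ_iff_derivWithin hu]
  exact ⟨fun Y hY => (hV Y hY).differentiableWithinAt, by simp,
    hg.congr fun Y hY => (hV Y hY).derivWithin (hu Y hY)⟩

theorem isSteadySol_of_derivWithin {α κ n R ε : ℝ} (hε : 0 < ε) {b V : ℝ → ℝ}
    (hb : Continuous b)
    (hV : ∀ Y ∈ Icc 0 R, Fcy α κ n (derivWithin V (Icc 0 R) Y) = Bf b ε Y)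
    (hV0 : derivWithin V (Icc 0 R) 0 = 0) (hVR : V R = 0) : IsSteadySol α κ n R ε b V := by
  refine ⟨fun Y hY => ?_, hV0, hVR⟩
  refine (hasDerivAt_integral_weight hb ε Y).hasDerivWithinAt.congr_of_mem (fun y hy => ?_)
    (Ioo_subset_Icc_self hY)
  have hne : y + ε ≠ 0 := by have := hy.1; positivity
  rw [← add_mul_Bf b hne, ← hV y hy, Fcy]
  ring

theorem IsSteadySol.Fcy_derivWithin {α κ n R ε : ℝ} (hα : 0 < α) (hκ : 0 ≤ κ) (hR : 0 < R)
    (hε : 0 < ε) {b W : ℝ → ℝ} (hb : Continuous b) (hW : ContDiffOn ℝ 2 W (Icc 0 R))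
    (h : IsSteadySol α κ n R ε b W) {Y : ℝ} (hY : Y ∈ Icc 0 R) :
    Fcy α κ n (derivWithin W (Icc 0 R) Y) = Bf b ε Y := by
  obtain ⟨hode, h0, -⟩ := h
  have hcF : Continuous (Fcy α κ n) :=
    continuous_iff_continuousAt.mpr fun η => (hasDerivAt_Fcy n hα hκ η).continuousAt
  have hcW : ContinuousOn (derivWithin W (Icc 0 R)) (Icc 0 R) :=
    hW.continuousOn_derivWithin (uniqueDiffOn_Icc hR) (by norm_num)
  set P : ℝ → ℝ := fun y => (1 + κ ^ α * |derivWithin W (Icc 0 R) y| ^ α) ^ ((n - 1) / α) *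
    ((y + ε) * derivWithin W (Icc 0 R) y) with hP
  have hPF : ∀ y, P y = (y + ε) * Fcy α κ n (derivWithin W (Icc 0 R) y) := fun y => by
    simp only [hP, Fcy]; ring
  have hcP : ContinuousOn P (Icc 0 R) := by
    rw [funext hPF]
    exact (by fun_prop : Continuous fun y : ℝ => y + ε).continuousOn.mul
      (hcF.comp_continuousOn hcW)
  have hcw : Continuous fun s => (s + ε) * b s := by fun_prop
  have hint := integral_eq_sub_of_hasDerivAt_of_le hY.1
    (hcP.mono (Icc_subset_Icc_right hY.2))
    (fun y hy => (hode y ⟨hy.1, hy.2.trans_le hY.2⟩).hasDerivAt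
      (Icc_mem_nhds hy.1 (hy.2.trans_le hY.2)))
    (hcw.intervalIntegrable 0 Y)
  have hne : Y + ε ≠ 0 := by have := hY.1; positivity
  rw [← add_mul_Bf b hne, hPF, hPF, h0] at hint
  have hF0 : Fcy α κ n 0 = 0 := by simp [Fcy]
  rw [hF0, mul_zero, sub_zero] at hint
  exact (mul_left_cancel₀ hne hint).symm

theorem eq_neg_integral_of_derivWithin {R : ℝ} (hR : 0 < R) {W g : ℝ → ℝ}
    (hW : ContDiffOn ℝ 2 W (Icc 0 R)) (hWR : W R = 0)
    (hg : ∀ Y ∈ Icc 0 R, derivWithin W (Icc 0 R) Y = g Y) {Y : ℝ} (hY : Y ∈ Icc 0 R) :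
    W Y = -∫ s in Y..R, g s := by
  have hcg : ContinuousOn g (Icc 0 R) :=
    (hW.continuousOn_derivWithin (uniqueDiffOn_Icc hR) (by norm_num)).congr
      fun y hy => (hg y hy).symm
  have hsub : Icc Y R ⊆ Icc 0 R := Icc_subset_Icc_left hY.1
  have h := integral_eq_sub_of_hasDerivAt_of_le hY.2 (hW.continuousOn.mono hsub)
    (fun y hy => by
      have hy' : y ∈ Icc 0 R := hsub (Ioo_subset_Icc_self hy)
      have hd := ((hW.differentiableOn (by norm_num)) y hy').hasDerivWithinAt
      rw [hg y hy'] at hd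
      exact hd.hasDerivAt (Icc_mem_nhds (hY.1.trans_lt hy.1) hy.2))
    ((hcg.mono hsub).intervalIntegrable_of_Icc hY.2)
  rw [h, hWR]
  ring

theorem IsSteadySol.congr {α κ n R ε : ℝ} {b b' V : ℝ → ℝ} (hbb' : EqOn b b' (Icc 0 R))
    (h : IsSteadySol α κ n R ε b V) : IsSteadySol α κ n R ε b' V :=
  ⟨fun Y hY => by
    rw [← hbb' (Ioo_subset_Icc_self hY)]
    exact h.1 Y hY, h.2⟩

/-- Theorem 1: for `α > 0` and either `n > 0, κ ≠ 0` or `κ = 0`,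
`F` is a strictly increasing bijection of `[0,∞)` onto itself with inverse `F⁻¹`;
for each `ε ∈ (0,ε₀]` the regularized steady problem has the unique classical
`C²([0,R])` solution `V^ε(Y) = −∫_Y^R F⁻¹(B_ε(s)) ds`, and
`0 ≤ (V^ε)'(Y) ≤ F⁻¹(B_{ε₀}(Y)) ≤ F⁻¹(b₀(R+ε₀)/2)` on `[0,R]`. -/
theorem stmt3 (α κ n R b₀ ε₀ : ℝ) (b : ℝ → ℝ)
    (hα : 0 < α) (hκ : 0 ≤ κ) (hcase : (0 < n ∧ κ ≠ 0) ∨ κ = 0)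
    (hR : 0 < R) (hε₀ : 0 < ε₀) (hε₀R : ε₀ < R)
    (hb : ContDiffOn ℝ 2 b (Icc 0 R))
    (hbb : ∀ Y ∈ Icc 0 R, 0 ≤ b Y ∧ b Y ≤ b₀)
    (hbne : ∃ Y ∈ Ioo 0 R, b Y ≠ 0) :
    ∃ G : ℝ → ℝ,
      StrictMonoOn (Fcy α κ n) (Ici 0) ∧
      BijOn (Fcy α κ n) (Ici 0) (Ici 0) ∧
      InvOn G (Fcy α κ n) (Ici 0) (Ici 0) ∧
      ∀ ε ∈ Ioc 0 ε₀,
        (ContDiffOn ℝ 2 (fun Y => -∫ s in Y..R, G (Bf b ε s)) (Icc 0 R) ∧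
          IsSteadySol α κ n R ε b (fun Y => -∫ s in Y..R, G (Bf b ε s))) ∧
        (∀ W : ℝ → ℝ, ContDiffOn ℝ 2 W (Icc 0 R) → IsSteadySol α κ n R ε b W →
          ∀ Y ∈ Icc 0 R, W Y = -∫ s in Y..R, G (Bf b ε s)) ∧
        (∀ Y ∈ Icc 0 R,
          0 ≤ derivWithin (fun y => -∫ s in y..R, G (Bf b ε s)) (Icc 0 R) Y ∧
          derivWithin (fun y => -∫ s in y..R, G (Bf b ε s)) (Icc 0 R) Y ≤ G (Bf b ε₀ Y) ∧
          G (Bf b ε₀ Y) ≤ G (b₀ * (R + ε₀) / 2)) := by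
  obtain ⟨G, hGl, hGr, hGm, hGc⟩ := exists_inverse_Fcy hα hκ hcase
  have hFm := strictMono_Fcy hα hκ hcase
  have hF0 : Fcy α κ n 0 = 0 := by simp [Fcy]
  have hG0 : G 0 = 0 := by simpa [hF0] using hGl 0
  have hFmaps : MapsTo (Fcy α κ n) (Ici 0) (Ici 0) := fun x hx => by
    have := hFm.monotone (mem_Ici.mp hx)
    rwa [hF0] at this
  have hGmaps : MapsTo G (Ici 0) (Ici 0) := fun x hx => by
    have := hGm.monotone (mem_Ici.mp hx)
    rwa [hG0] at this
  have hinv : InvOn G (Fcy α κ n) (Ici 0) (Ici 0) := ⟨fun x _ => hGl x, fun x _ => hGr x⟩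
  refine ⟨G, hFm.strictMonoOn _, hinv.bijOn hFmaps hGmaps, hinv, ?_⟩
  rintro ε ⟨hε, hεε₀⟩
  set c : ℝ → ℝ := IccExtend hR.le ((Icc 0 R).domRestrict b) with hc_def
  have hc : Continuous c := (continuousOn_iff_continuous_domRestrict.mp hb.continuousOn).Icc_extend'
  have hbc : EqOn b c (Icc 0 R) := fun y hy => (IccExtend_of_mem hR.le ((Icc 0 R).domRestrict b) hy).symm
  have hcb : ∀ y, 0 ≤ c y ∧ c y ≤ b₀ := fun y => hbb _ (projIcc 0 R hR.le y).2
  have hb₀ : 0 ≤ b₀ := (hcb 0).1.trans (hcb 0).2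
  have hg1 : ContDiffOn ℝ 1 (fun s => G (Bf b ε s)) (Icc 0 R) :=
    hGc.comp_contDiffOn ((contDiffOn_Bf hc hε R).congr fun y hy => Bf_congr ε hbc hy)
  have hV : ∀ Y ∈ Icc 0 R, HasDerivWithinAt (fun y => -∫ s in y..R, G (Bf b ε s))
      (G (Bf b ε Y)) (Icc 0 R) Y := fun Y hY =>
    hasDerivWithinAt_neg_integral hg1.continuousOn hY
  have hV' : ∀ Y ∈ Icc 0 R, derivWithin (fun y => -∫ s in y..R, G (Bf b ε s)) (Icc 0 R) Y =
      G (Bf b ε Y) := fun Y hY => (hV Y hY).derivWithin (uniqueDiffOn_Icc hR Y hY)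
  refine ⟨⟨contDiffOn_two_of_hasDerivWithinAt hR hV hg1, ?_⟩, fun W hW hWs Y hY => ?_,
    fun Y hY => ?_⟩
  · refine (isSteadySol_of_derivWithin hε hc (fun Y hY => ?_) ?_ ?_).congr hbc.symm
    · rw [hV' Y hY, hGr, Bf_congr ε hbc hY]
    · rw [hV' 0 (left_mem_Icc.mpr hR.le), Bf_zero, hG0]
    · simp
  · refine eq_neg_integral_of_derivWithin hR hW hWs.2.2 (fun y hy => ?_) hY
    rw [Bf_congr ε hbc hy, ← (hWs.congr hbc).Fcy_derivWithin hα hκ hR hε hc hW hy, hGl]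
  · rw [hV' Y hY, Bf_congr ε hbc hY, Bf_congr ε₀ hbc hY]
    exact ⟨hGmaps (Bf_nonneg (fun y => (hcb y).1) hε hY.1),
      hGm.monotone (Bf_mono hc (fun y => (hcb y).1) hε hεε₀ hY.1),
      hGm.monotone (Bf_le hc (fun y => (hcb y).2) hb₀ hε₀ hY)⟩
end

section
/- (Theorem 2(i), necessity) Suppose α > 0, κ ≠ 0, n = 0, and fix ε ∈ (0, ε₀]. If the regularized steady problem (1/(Y+ε)) d/dY[ (1 + κ^α |V'(Y)|^α)^{(n−1)/α} (Y+ε) V'(Y) ] = b(Y) on (0,R), V'(0) = 0, V(R) = 0, has a classical solution V^ε ∈ C¹([0,R]) ∩ C²([0,R)), then necessarily B_ε(Y) ≤ κ^{−1} for every Y ∈ [0,R]. -/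
open Set Filter Real intervalIntegral

/-- The Carreau-Yasuda flux with `n = 0` never exceeds `κ⁻¹`. -/
theorem carreauYasuda_flux_le_inv {α κ : ℝ} (hα : 0 < α) (hκ : 0 < κ) (v : ℝ) :
    (1 + κ ^ α * |v| ^ α) ^ ((0 - 1) / α) * v ≤ κ⁻¹ := by
  have hprod : (κ * |v|) ^ α = κ ^ α * |v| ^ α := mul_rpow hκ.le (abs_nonneg v)
  have hnonneg : 0 ≤ κ ^ α * |v| ^ α := by positivity
  have hbase : 0 < 1 + κ ^ α * |v| ^ α := by positivity
  have hroot : κ * |v| ≤ (1 + κ ^ α * |v| ^ α) ^ (1 / α) := by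
    calc κ * |v| = ((κ * |v|) ^ α) ^ (1 / α) := by
          rw [← rpow_mul (by positivity), mul_one_div_cancel hα.ne', rpow_one]
      _ ≤ _ := by
          rw [hprod]
          exact rpow_le_rpow hnonneg (by linarith) (by positivity)
  have hpos : 0 < (1 + κ ^ α * |v| ^ α) ^ (1 / α) := rpow_pos_of_pos hbase _
  have hexp : (0 - 1) / α = -(1 / α) := by ring
  rw [hexp, rpow_neg hbase.le, inv_mul_eq_div, div_le_iff₀ hpos, inv_mul_eq_div, le_div_iff₀ hκ]
  nlinarith [le_abs_self v]

/-- Theorem 2(i), necessity: for `α > 0`, `κ ≠ 0`, `n = 0`,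
`ε ∈ (0,ε₀]`: if the regularized steady problem has a classical solution
`V ∈ C¹([0,R]) ∩ C²([0,R))`, then `B_ε(Y) ≤ κ⁻¹` for every `Y ∈ [0,R]`. -/
theorem stmt5 (α κ n R b₀ ε₀ ε : ℝ) (b V : ℝ → ℝ)
    (hα : 0 < α) (hκ : 0 ≤ κ) (hκ' : κ ≠ 0) (hn : n = 0)
    (hR : 0 < R) (hε₀ : 0 < ε₀) (hε₀R : ε₀ < R) (hε : ε ∈ Ioc 0 ε₀)
    (hb : ContDiffOn ℝ 2 b (Icc 0 R))
    (hbb : ∀ Y ∈ Icc 0 R, 0 ≤ b Y ∧ b Y ≤ b₀)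
    (hbne : ∃ Y ∈ Ioo 0 R, b Y ≠ 0)
    (hV1 : ContDiffOn ℝ 1 V (Icc 0 R))
    (hV2 : ContDiffOn ℝ 2 V (Ico 0 R))
    (hsol : IsSteadySol α κ n R ε b V) :
    ∀ Y ∈ Icc 0 R, Bf b ε Y ≤ κ⁻¹ := by
  subst hn
  intro Y hY
  obtain ⟨hode, hv0, -⟩ := hsol
  have hκpos : 0 < κ := lt_of_le_of_ne hκ (Ne.symm hκ')
  have hv : ContinuousOn (derivWithin V (Icc 0 R)) (Icc 0 R) :=
    hV1.continuousOn_derivWithin (uniqueDiffOn_Icc hR) le_rfl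
  have hsub : Icc 0 Y ⊆ Icc 0 R := Icc_subset_Icc_right hY.2
  have hflux : ContinuousOn
      (fun y => (1 + κ ^ α * |derivWithin V (Icc 0 R) y| ^ α) ^ ((0 - 1) / α) *
        ((y + ε) * derivWithin V (Icc 0 R) y)) (Icc 0 R) := by
    refine ContinuousOn.mul (ContinuousOn.rpow_const ?_ fun y _ => Or.inl ?_) ?_
    · exact continuousOn_const.add
        (continuousOn_const.mul (hv.abs.rpow_const fun _ _ => Or.inr hα.le))
    · positivity
    · exact (continuousOn_id.add continuousOn_const).mul hv
  have hint : IntervalIntegrable (fun s => (s + ε) * b s) MeasureTheory.volume 0 Y :=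
    ContinuousOn.intervalIntegrable_of_Icc hY.1
      (((continuousOn_id.add continuousOn_const).mul hb.continuousOn).mono hsub)
  have hftc := integral_eq_sub_of_hasDerivAt_of_le hY.1 (hflux.mono hsub)
    (fun y hy => (hode y ⟨hy.1, hy.2.trans_le hY.2⟩).hasDerivAt
      (Icc_mem_nhds hy.1 (hy.2.trans_le hY.2))) hint
  have hYε : Y + ε ≠ 0 := (add_pos_of_nonneg_of_pos hY.1 hε.1).ne'
  have hB : Bf b ε Y = (1 + κ ^ α * |derivWithin V (Icc 0 R) Y| ^ α) ^ ((0 - 1) / α) *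
      derivWithin V (Icc 0 R) Y := by
    rw [Bf, hftc, hv0]
    field_simp
    ring
  rw [hB]
  exact carreauYasuda_flux_le_inv hα hκpos _
end

section
/- (Theorem 2(ii), necessity) Suppose α > 0, κ ≠ 0, n < 0, set η₀ = κ^{−1}(−1/n)^{1/α} and ζ₀ = ((n−1)/n)^{(n−1)/α} κ^{−1} (−1/n)^{1/α}, and fix ε ∈ (0, ε₀]. If the regularized steady problem (1/(Y+ε)) d/dY[ (1 + κ^α |V'(Y)|^α)^{(n−1)/α} (Y+ε) V'(Y) ] = b(Y) on (0,R), V'(0) = 0, V(R) = 0, has a classical solution V^ε ∈ C¹([0,R]) ∩ C²([0,R)), then necessarily B_ε(Y) ≤ ζ₀ for every Y ∈ [0,R]. -/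
open Set Filter Real intervalIntegral

/-- For `n < 0`, the function `t ↦ (1+t)^(n-1) t` on `[0,∞)` is maximal at `t = -1/n`. -/
theorem one_add_rpow_mul_self_le {n t : ℝ} (hn : n < 0) (ht : 0 ≤ t) :
    (1 + t) ^ (n - 1) * t ≤ ((n - 1) / n) ^ (n - 1) * (-1 / n) := by
  have hq : 0 < (n - 1) / n := div_pos_of_neg_of_neg (by linarith) hn
  have hx : 1 + ((1 + t) / ((n - 1) / n) - 1) = (1 + t) / ((n - 1) / n) := by ring
  have bern := one_add_mul_self_le_rpow_one_add
    (s := (1 + t) / ((n - 1) / n) - 1) (p := 1 - n) (by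
      have : 0 ≤ (1 + t) / ((n - 1) / n) := by positivity
      linarith) (by linarith)
  have hlin : 1 + (1 - n) * ((1 + t) / ((n - 1) / n) - 1) = -n * t := by
    have : n - 1 ≠ 0 := by linarith
    have := hn.ne
    field_simp
    ring
  rw [hx, hlin, div_rpow (by linarith) hq.le, le_div_iff₀ (by positivity)] at bern
  have e : n - 1 = -(1 - n) := by ring
  have e1 : (1 + t) ^ (n - 1) = ((1 + t) ^ (1 - n))⁻¹ := by
    rw [← rpow_neg (by linarith), ← e]
  have e2 : ((n - 1) / n) ^ (n - 1) = (((n - 1) / n) ^ (1 - n))⁻¹ := by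
    rw [← rpow_neg hq.le, ← e]
  have hA : 0 < (1 + t) ^ (1 - n) := by positivity
  have hB : 0 < ((n - 1) / n) ^ (1 - n) := by positivity
  rw [e1, e2, inv_mul_eq_div, inv_mul_eq_div, div_le_div_iff₀ hA hB, div_mul_eq_mul_div,
    le_div_iff_of_neg hn]
  linarith

/-- For `n < 0`, the Carreau-Yasuda flux is bounded above by its value at `κ⁻¹ (-1/n)^(1/α)`. -/
theorem carreauFlux_le {α κ n : ℝ} (hα : 0 < α) (hκ : 0 < κ) (hn : n < 0) (η : ℝ) :
    (1 + κ ^ α * |η| ^ α) ^ ((n - 1) / α) * η ≤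
      ((n - 1) / n) ^ ((n - 1) / α) * κ⁻¹ * (-1 / n) ^ (1 / α) := by
  have hs : 0 < -1 / n := div_pos_of_neg_of_neg (by norm_num) hn
  have hq : 0 < (n - 1) / n := div_pos_of_neg_of_neg (by linarith) hn
  rcases le_or_gt η 0 with hη | hη
  · exact (mul_nonpos_of_nonneg_of_nonpos (by positivity) hη).trans (by positivity)
  · rw [abs_of_pos hη, ← mul_rpow hκ.le hη.le]
    have ht : 0 < (κ * η) ^ α := by positivity
    have key := rpow_le_rpow (by positivity) (one_add_rpow_mul_self_le hn ht.le)
      (one_div_nonneg.2 hα.le)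
    rw [mul_rpow (by positivity) ht.le, mul_rpow (by positivity) hs.le, ← rpow_mul (by positivity),
      ← rpow_mul hq.le, ← rpow_mul (by positivity), mul_one_div_cancel hα.ne', rpow_one,
      mul_one_div] at key
    have := mul_le_mul_of_nonneg_left key (inv_pos.2 hκ).le
    calc _ = κ⁻¹ * ((1 + (κ * η) ^ α) ^ ((n - 1) / α) * (κ * η)) := by
          rw [mul_left_comm, inv_mul_cancel_left₀ hκ.ne']
      _ ≤ _ := this
      _ = _ := by ring

/-- First integral of the steady problem: the flux equals the averaged pressure gradient. -/
theorem IsSteadySol.flux_eq_Bf {α κ n R ε : ℝ} {b V : ℝ → ℝ} (hα : 0 < α) (hκ : 0 ≤ κ)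
    (hR : 0 < R) (hε : 0 < ε) (hb : ContinuousOn b (Icc 0 R)) (hV : ContDiffOn ℝ 1 V (Icc 0 R))
    (hsol : IsSteadySol α κ n R ε b V) {Y : ℝ} (hY : Y ∈ Icc 0 R) :
    (1 + κ ^ α * |derivWithin V (Icc 0 R) Y| ^ α) ^ ((n - 1) / α) * derivWithin V (Icc 0 R) Y =
      Bf b ε Y := by
  have hsub : Icc 0 Y ⊆ Icc 0 R := Icc_subset_Icc_right hY.2
  have hW : ContinuousOn (derivWithin V (Icc 0 R)) (Icc 0 R) :=
    hV.continuousOn_derivWithin (uniqueDiffOn_Icc hR) le_rfl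
  have hbase : ContinuousOn (fun y => 1 + κ ^ α * |derivWithin V (Icc 0 R) y| ^ α) (Icc 0 R) :=
    continuousOn_const.add (continuousOn_const.mul (hW.abs.rpow_const fun _ _ => Or.inr hα.le))
  have hG : ContinuousOn
      (fun y => (1 + κ ^ α * |derivWithin V (Icc 0 R) y| ^ α) ^ ((n - 1) / α) *
        ((y + ε) * derivWithin V (Icc 0 R) y)) (Icc 0 R) := (hbase.rpow_const (p := (n - 1) / α) fun y _ => Or.inl (by positivity)).mul
    (((continuous_id.add continuous_const).continuousOn (f := fun y => y + ε)).mul hW)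
  have hint : IntervalIntegrable (fun s => (s + ε) * b s) MeasureTheory.volume 0 Y := by
    apply ContinuousOn.intervalIntegrable
    rw [uIcc_of_le hY.1]
    exact ((continuous_id.add continuous_const).continuousOn (f := fun y => y + ε)).mul
      (hb.mono hsub)
  have ftc := integral_eq_sub_of_hasDerivAt_of_le hY.1 (hG.mono hsub)
    (fun y hy => (hsol.1 y ⟨hy.1, hy.2.trans_le hY.2⟩).hasDerivAt
      (Icc_mem_nhds hy.1 (hy.2.trans_le hY.2))) hint
  have hYε : Y + ε ≠ 0 := by linarith [hY.1]
  rw [hsol.2.1, mul_zero, mul_zero, sub_zero] at ftc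
  rw [Bf, ftc]
  field_simp

/-- Theorem 2(ii), necessity: for `α > 0`, `κ ≠ 0`, `n < 0`,
`ζ₀ = ((n−1)/n)^{(n−1)/α} κ⁻¹ (−1/n)^{1/α}`, `ε ∈ (0,ε₀]`: if the regularized steady
problem has a classical solution `V ∈ C¹([0,R]) ∩ C²([0,R))`, then `B_ε(Y) ≤ ζ₀`
for every `Y ∈ [0,R]`. -/
theorem stmt7 (α κ n R b₀ ε₀ ε : ℝ) (b V : ℝ → ℝ)
    (hα : 0 < α) (hκ : 0 ≤ κ) (hκ' : κ ≠ 0) (hn : n < 0)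
    (hR : 0 < R) (hε₀ : 0 < ε₀) (hε₀R : ε₀ < R) (hε : ε ∈ Ioc 0 ε₀)
    (hb : ContDiffOn ℝ 2 b (Icc 0 R))
    (hbb : ∀ Y ∈ Icc 0 R, 0 ≤ b Y ∧ b Y ≤ b₀)
    (hbne : ∃ Y ∈ Ioo 0 R, b Y ≠ 0)
    (hV1 : ContDiffOn ℝ 1 V (Icc 0 R))
    (hV2 : ContDiffOn ℝ 2 V (Ico 0 R))
    (hsol : IsSteadySol α κ n R ε b V) :
    ∀ Y ∈ Icc 0 R,
      Bf b ε Y ≤ ((n - 1) / n) ^ ((n - 1) / α) * κ⁻¹ * (-1 / n) ^ (1 / α) := by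
  intro Y hY
  rw [← hsol.flux_eq_Bf hα hκ hR hε.1 hb.continuousOn hV1 hY]
  exact carreauFlux_le hα (hκ.lt_of_ne' hκ') hn _
end

section
/- (Lemma 3.1) Suppose α > 0, β > 0, and either n ≥ 1 with κ ≠ 0, or κ = 0 with n ∈ ℝ arbitrary. Let ε ∈ (0, ε₀] and let U^ε ∈ C²(Q) ∩ C¹(Q̄) be a solution of the regularized unsteady problem. Set K₁ = max{ sup_{Y∈[0,R)} |Ψ(Y)/(R²−Y²)|, b₀/2 }. Then |U^ε(T,Y)| ≤ K₁(R²−Y²) ≤ K₁R² for all T ≥ 0 and Y ∈ [0,R], and |∂U^ε/∂Y (T,R)| ≤ 2K₁R for all T ≥ 0. -/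
open Set Filter Real intervalIntegral

/-- Partial derivative in time, taken within the time set `S`. -/
noncomputable def pT (S : Set ℝ) (U : ℝ → ℝ → ℝ) (T Y : ℝ) : ℝ :=
  derivWithin (fun t => U t Y) S T

/-- Partial derivative in the radial variable, taken within `[0,R]`. -/
noncomputable def pY (R : ℝ) (U : ℝ → ℝ → ℝ) (T Y : ℝ) : ℝ :=
  derivWithin (U T) (Icc 0 R) Y

/-- Second partial derivative in the radial variable, taken within `[0,R]`. -/
noncomputable def pYY (R : ℝ) (U : ℝ → ℝ → ℝ) (T Y : ℝ) : ℝ :=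
  derivWithin (fun y => pY R U T y) (Icc 0 R) Y

/-- The Carreau–Yasuda viscosity coefficient
`Φ(η) = (1 + n κ^α η^α)(1 + κ^α η^α)^{(n−1−α)/α}`. -/
noncomputable def Phi (α κ n : ℝ) (η : ℝ) : ℝ :=
  (1 + n * κ ^ α * η ^ α) * (1 + κ ^ α * η ^ α) ^ ((n - 1 - α) / α)

/-- `U` solves the regularized unsteady problem (non-divergence form):
`8β² U_T − Φ(|U_Y|) U_{YY} − (1/(Y+ε))(1+κ^α|U_Y|^α)^{(n−1)/α} U_Y = b(Y)` in `Q`,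
`U_Y(T,0) = U(T,R) = 0` for `T ≥ 0`, `U(0,Y) = Ψ(Y)` on `[0,R]`. -/
def RegUnsteadySol (α κ n β R ε : ℝ) (b Ψ : ℝ → ℝ) (U : ℝ → ℝ → ℝ) : Prop :=
  (∀ T > 0, ∀ Y ∈ Ioo 0 R,
    8 * β ^ 2 * pT (Ici 0) U T Y - Phi α κ n |pY R U T Y| * pYY R U T Y
      - (Y + ε)⁻¹ * (1 + κ ^ α * |pY R U T Y| ^ α) ^ ((n - 1) / α) * pY R U T Y = b Y) ∧
  (∀ T ≥ 0, pY R U T 0 = 0 ∧ U T R = 0) ∧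
  (∀ Y ∈ Icc 0 R, U 0 Y = Ψ Y)

/-- Compatibility conditions for the initial datum `Ψ`:
`Ψ'(0) = Ψ(R) = Ψ'(R) = 0` and `Ψ''(R) + b(R) = 0`. -/
def PsiCompat (R : ℝ) (b Ψ : ℝ → ℝ) : Prop :=
  derivWithin Ψ (Icc 0 R) 0 = 0 ∧ Ψ R = 0 ∧ derivWithin Ψ (Icc 0 R) R = 0 ∧
    derivWithin (derivWithin Ψ (Icc 0 R)) (Icc 0 R) R + b R = 0

open scoped Topology

/-- The viscosity coefficient is at least `1` in the shear-thickening or Newtonian case. -/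
lemma one_le_Phi {α κ n η : ℝ} (hα : 0 < α) (hκ : 0 ≤ κ)
    (hcase : (1 ≤ n ∧ κ ≠ 0) ∨ κ = 0) (hη : 0 ≤ η) : 1 ≤ Phi α κ n η := by
  unfold Phi
  rcases hcase with ⟨hn, -⟩ | rfl
  · have hx : 0 ≤ κ ^ α * η ^ α := by positivity
    rw [mul_assoc]
    set x := κ ^ α * η ^ α
    calc (1 : ℝ) ≤ (1 + x) ^ ((n - 1) / α) :=
          Real.one_le_rpow (by linarith) (div_nonneg (by linarith) hα.le)
      _ = (1 + x) * (1 + x) ^ ((n - 1 - α) / α) := by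
          have h : (n - 1) / α = 1 + (n - 1 - α) / α := by field_simp; ring
          rw [h, Real.rpow_add (by linarith), Real.rpow_one]
      _ ≤ (1 + n * x) * (1 + x) ^ ((n - 1 - α) / α) := by
          gcongr
          nlinarith
  · simp [Real.zero_rpow hα.ne']

/-- The derivative from the left at a left-sided maximum is nonnegative. -/
lemma HasDerivWithinAt.nonneg_of_le_on_left {f : ℝ → ℝ} {s : Set ℝ} {a x d : ℝ} (hax : a < x)
    (hs : Ioo a x ⊆ s) (hf : HasDerivWithinAt f d s x) (hle : ∀ t ∈ Ioo a x, f t ≤ f x) :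
    0 ≤ d := by
  have h := (hasDerivWithinAt_iff_tendsto_slope' (by simp)).1 (hf.mono hs)
  have : (𝓝[Ioo a x] x).NeBot := by
    rw [nhdsWithin_Ioo_eq_nhdsLT hax]; infer_instance
  refine ge_of_tendsto h ?_
  filter_upwards [self_mem_nhdsWithin] with t ht
  rw [slope_def_field]
  exact div_nonneg_of_nonpos (by linarith [hle t ht]) (by linarith [ht.2])

/-- The derivative from the right at a right-sided maximum is nonpositive. -/
lemma HasDerivWithinAt.nonpos_of_le_on_right {f : ℝ → ℝ} {s : Set ℝ} {x c d : ℝ} (hxc : x < c)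
    (hs : Ioo x c ⊆ s) (hf : HasDerivWithinAt f d s x) (hle : ∀ t ∈ Ioo x c, f t ≤ f x) :
    d ≤ 0 := by
  have h := (hasDerivWithinAt_iff_tendsto_slope' (by simp)).1 (hf.mono hs)
  have : (𝓝[Ioo x c] x).NeBot := by
    rw [nhdsWithin_Ioo_eq_nhdsGT hxc]; infer_instance
  refine le_of_tendsto h ?_
  filter_upwards [self_mem_nhdsWithin] with t ht
  rw [slope_def_field]
  exact div_nonpos_of_nonpos_of_nonneg (by linarith [hle t ht]) (by linarith [ht.1])

/-- Second-order necessary condition at a local maximum. -/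
lemma IsLocalMax.deriv_deriv_nonpos {f : ℝ → ℝ} {x : ℝ} (h : IsLocalMax f x)
    (hc : ContinuousAt f x) : deriv (deriv f) x ≤ 0 := by
  by_contra! hpos
  have hmin := isLocalMin_of_deriv_deriv_pos hpos h.deriv_eq_zero hc
  have heq : f =ᶠ[𝓝 x] fun _ => f x := by
    filter_upwards [h, hmin] with y h1 h2 using le_antisymm h1 h2
  have h0 : deriv (deriv f) x = 0 := by
    rw [heq.deriv.deriv_eq]; simp
  exact hpos.ne' h0

lemma pY_eq_deriv {R T Y : ℝ} {U : ℝ → ℝ → ℝ} (hY : Y ∈ Ioo 0 R) :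
    pY R U T Y = deriv (U T) Y :=
  derivWithin_of_mem_nhds (Icc_mem_nhds hY.1 hY.2)

lemma pYY_eq_deriv {R T Y : ℝ} {U : ℝ → ℝ → ℝ} (hY : Y ∈ Ioo 0 R) :
    pYY R U T Y = deriv (deriv (U T)) Y := by
  unfold pYY
  rw [derivWithin_of_mem_nhds (Icc_mem_nhds hY.1 hY.2)]
  apply Filter.EventuallyEq.deriv_eq
  filter_upwards [Ioo_mem_nhds hY.1 hY.2] with y hy using pY_eq_deriv hy

/-- At an interior spatial maximum of `U + K Y² + μ Y`, the gradient of `U` is determined and its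
second derivative is at most `-2K`. -/
lemma pY_eq_and_pYY_le_of_isLocalMax {R T Y K μ : ℝ} {U : ℝ → ℝ → ℝ} (hY : Y ∈ Ioo 0 R)
    (hU : ContDiffAt ℝ 2 (U T) Y)
    (hmax : IsLocalMax (fun y => U T y + (K * y ^ 2 + μ * y)) Y) :
    pY R U T Y = -(2 * K * Y + μ) ∧ pYY R U T Y ≤ -(2 * K) := by
  have hq (y : ℝ) : HasDerivAt (fun y : ℝ => K * y ^ 2 + μ * y) (2 * K * y + μ) y := by
    simpa [mul_assoc, mul_left_comm] using
      ((hasDerivAt_pow 2 y).const_mul K).fun_add ((hasDerivAt_id' y).const_mul μ)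
  have hl : HasDerivAt (fun y : ℝ => 2 * K * y + μ) (2 * K) Y := by
    simpa using ((hasDerivAt_id Y).const_mul (2 * K)).add_const μ
  have hU1 : ∀ᶠ y in 𝓝 Y, DifferentiableAt ℝ (U T) y :=
    (hU.eventually (by simp)).mono fun y hy => hy.differentiableAt (by simp)
  have hd : deriv (fun y => U T y + (K * y ^ 2 + μ * y)) =ᶠ[𝓝 Y]
      fun y => deriv (U T) y + (2 * K * y + μ) :=
    hU1.mono fun y hy => (hy.hasDerivAt.add (hq y)).deriv
  have hU2 : DifferentiableAt ℝ (deriv (U T)) Y :=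
    (hU.derivWithin (m := 1) (by norm_num)).differentiableAt (by simp)
  have h1 := hmax.deriv_eq_zero
  have h2 := hmax.deriv_deriv_nonpos
    (hU1.self_of_nhds.continuousAt.add (hq Y).continuousAt)
  rw [hd.self_of_nhds] at h1
  rw [hd.deriv_eq, (hU2.hasDerivAt.fun_add hl).deriv] at h2
  rw [pY_eq_deriv hY, pYY_eq_deriv hY]
  constructor <;> linarith

/-- The one-sided comparison principle: a solution with source at most `2K` which lies below
`K (R² - Y²)` initially stays below it. -/
lemma le_paraboloid_of_source_le {α β κ n R ε K : ℝ} {f : ℝ → ℝ} {U : ℝ → ℝ → ℝ}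
    (hα : 0 < α) (hβ : 0 < β) (hκ : 0 ≤ κ)
    (hcase : (1 ≤ n ∧ κ ≠ 0) ∨ κ = 0) (hR : 0 < R) (hε : 0 < ε) (hK : 0 ≤ K)
    (hf : ∀ Y ∈ Ioo 0 R, f Y ≤ 2 * K)
    (hreg2 : ContDiffOn ℝ 2 (fun p : ℝ × ℝ => U p.1 p.2) (Ioi 0 ×ˢ Ioo 0 R))
    (hreg1 : ContDiffOn ℝ 1 (fun p : ℝ × ℝ => U p.1 p.2) (Ici 0 ×ˢ Icc 0 R))
    (hpde : ∀ T > 0, ∀ Y ∈ Ioo 0 R,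
      8 * β ^ 2 * pT (Ici 0) U T Y - Phi α κ n |pY R U T Y| * pYY R U T Y
        - (Y + ε)⁻¹ * (1 + κ ^ α * |pY R U T Y| ^ α) ^ ((n - 1) / α) * pY R U T Y = f Y)
    (hbc : ∀ T ≥ 0, pY R U T 0 = 0 ∧ U T R = 0)
    (hinit : ∀ Y ∈ Icc 0 R, U 0 Y ≤ K * (R ^ 2 - Y ^ 2))
    {T Y : ℝ} (hT : 0 ≤ T) (hY : Y ∈ Icc 0 R) : U T Y ≤ K * (R ^ 2 - Y ^ 2) := by
  have key (δ : ℝ) (hδ : 0 < δ) :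
      U T Y + (K * Y ^ 2 + δ * Y) - δ * T ≤ K * R ^ 2 + δ * R := by
    set V : ℝ × ℝ → ℝ := fun p => U p.1 p.2 + (K * p.2 ^ 2 + δ * p.2) - δ * p.1 with hV
    have hcont : ContinuousOn V (Icc 0 T ×ˢ Icc 0 R) := by
      have := hreg1.continuousOn.mono (prod_mono_left (t := Icc 0 R)
        (Icc_subset_Ici_self : Icc 0 T ⊆ Ici 0))
      exact (this.add (by fun_prop)).sub (by fun_prop)
    obtain ⟨⟨t, y⟩, ⟨ht, hy⟩, hmax⟩ := (isCompact_Icc.prod isCompact_Icc).exists_isMaxOn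
      ⟨(T, Y), ⟨right_mem_Icc.2 hT, hY⟩⟩ hcont
    have hmax' (s z : ℝ) (hs : s ∈ Icc 0 T) (hz : z ∈ Icc 0 R) : V (s, z) ≤ V (t, y) :=
      hmax ⟨hs, hz⟩
    simp only at ht hy
    refine (hmax' T Y (right_mem_Icc.2 hT) hY).trans ?_
    have hδy : δ * y ≤ δ * R := by gcongr; exact hy.2
    rcases hy.2.eq_or_lt with rfl | hyR
    · simp only [hV, (hbc t ht.1).2]
      have := mul_nonneg hδ.le ht.1
      linarith
    rcases ht.1.eq_or_lt with rfl | ht0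
    · simp only [hV]
      linarith [hinit y hy]
    exfalso
    rcases hy.1.eq_or_lt with rfl | hy0
    · have hU0 : DifferentiableWithinAt ℝ (U t) (Icc 0 R) 0 :=
        ((hreg1.differentiableOn (by simp)) (t, 0) ⟨ht.1, hy⟩).comp (0 : ℝ)
          (f := fun z : ℝ => (t, z)) (by fun_prop) fun z hz => ⟨ht.1, hz⟩
      have hd0 := hU0.hasDerivWithinAt
      rw [show derivWithin (U t) (Icc 0 R) 0 = 0 from (hbc t ht.1).1] at hd0
      have hq : HasDerivAt (fun z : ℝ => K * z ^ 2 + δ * z - δ * t) δ 0 := by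
        simpa using (((hasDerivAt_pow 2 (0 : ℝ)).const_mul K).fun_add
          ((hasDerivAt_id' (0 : ℝ)).const_mul δ)).sub_const (δ * t)
      have := (hd0.add hq.hasDerivWithinAt).nonpos_of_le_on_right hyR Ioo_subset_Icc_self
        fun z hz => by
          have := hmax' t z ht (Ioo_subset_Icc_self hz)
          simp only [hV] at this
          simp only [Pi.add_apply]
          linarith
      linarith
    have hyI : y ∈ Ioo 0 R := ⟨hy0, hyR⟩
    have hU2 : ContDiffAt ℝ 2 (fun p : ℝ × ℝ => U p.1 p.2) (t, y) :=
      hreg2.contDiffAt ((isOpen_Ioi.prod isOpen_Ioo).mem_nhds ⟨ht0, hyI⟩)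
    have hUy : ContDiffAt ℝ 2 (U t) y :=
      hU2.comp y (f := fun z : ℝ => (t, z)) (by fun_prop)
    have hUt : DifferentiableAt ℝ (fun s => U s y) t :=
      (hU2.differentiableAt (by simp)).comp t (f := fun s : ℝ => (s, y)) (by fun_prop)
    obtain ⟨h1, h2⟩ := pY_eq_and_pYY_le_of_isLocalMax (K := K) (μ := δ) hyI hUy (by
      filter_upwards [Ioo_mem_nhds hy0 hyR] with z hz
      have := hmax' t z ht (Ioo_subset_Icc_self hz)
      simp only [hV] at this
      linarith)
    have h3 : 0 ≤ pT (Ici 0) U t y - δ := by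
      have hd : HasDerivWithinAt (fun s => U s y - δ * s) (pT (Ici 0) U t y - δ) (Ici 0) t := by
        simpa [pT] using hUt.differentiableWithinAt.hasDerivWithinAt.fun_sub
          ((hasDerivAt_id' t).hasDerivWithinAt.const_mul δ)
      refine hd.nonneg_of_le_on_left ht0 (fun s hs => hs.1.le) fun s hs => ?_
      have := hmax' s y ⟨hs.1.le, hs.2.le.trans ht.2⟩ hy
      simp only [hV] at this
      linarith
    have hp := hpde t ht0 y hyI
    have hΦ : 1 ≤ Phi α κ n |pY R U t y| := one_le_Phi hα hκ hcase (abs_nonneg _)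
    have hc : 0 ≤ (y + ε)⁻¹ * (1 + κ ^ α * |pY R U t y| ^ α) ^ ((n - 1) / α) := by positivity
    have hpY : pY R U t y ≤ 0 := by
      rw [h1]
      have : 0 ≤ 2 * K * y + δ := by positivity
      linarith
    have h4 := mul_nonpos_of_nonneg_of_nonpos hc hpY
    have h5 : Phi α κ n |pY R U t y| * pYY R U t y ≤ -(2 * K) := by nlinarith
    have h6 : 0 < 8 * β ^ 2 * pT (Ici 0) U t y := by
      have : 0 < pT (Ici 0) U t y := by linarith
      positivity
    linarith [hf y hyI]
  refine le_of_forall_pos_le_add fun η hη => ?_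
  have hden : 0 < T + R := by linarith
  have h := key (η / (T + R)) (by positivity)
  have h1 : η / (T + R) * T + η / (T + R) * R = η := by field_simp
  have h2 : 0 ≤ η / (T + R) * Y := mul_nonneg (by positivity) hY.1
  linarith

/-- A `C¹` function on `[0,R]` vanishing at `R` has bounded quotient by `R² - Y²`. -/
lemma bddAbove_abs_div_paraboloid {R : ℝ} (hR : 0 < R) {Ψ : ℝ → ℝ}
    (hΨ : ContDiffOn ℝ 1 Ψ (Icc 0 R)) (hΨR : Ψ R = 0) :
    BddAbove ((fun Y => |Ψ Y / (R ^ 2 - Y ^ 2)|) '' Ico 0 R) := by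
  have hu : UniqueDiffOn ℝ (Icc 0 R) := uniqueDiffOn_Icc hR
  obtain ⟨C, hC⟩ := isCompact_Icc.exists_bound_of_continuousOn
    (hΨ.continuousOn_derivWithin hu le_rfl)
  have hC0 : 0 ≤ C := (norm_nonneg _).trans (hC 0 ⟨le_rfl, hR.le⟩)
  refine ⟨C / R, ?_⟩
  rintro _ ⟨Y, hY, rfl⟩
  have h := (convex_Icc 0 R).norm_image_sub_le_of_norm_derivWithin_le
    (hΨ.differentiableOn (by simp)) hC (Ico_subset_Icc_self hY) (right_mem_Icc.2 hR.le)
  rw [hΨR, zero_sub, norm_neg, Real.norm_eq_abs, Real.norm_eq_abs,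
    abs_of_pos (sub_pos.2 hY.2)] at h
  have hRY : 0 < R - Y := sub_pos.2 hY.2
  have hpos : 0 < R ^ 2 - Y ^ 2 := by nlinarith [hY.1]
  simp only [abs_div, abs_of_pos hpos]
  rw [div_le_div_iff₀ hpos hR]
  calc |Ψ Y| * R ≤ C * (R - Y) * R := by gcongr
    _ ≤ C * (R ^ 2 - Y ^ 2) := by
      rw [mul_assoc]
      gcongr
      nlinarith [hY.1]

/-- A function vanishing at `R` and lying below the paraboloid `K (R² - Y²)` has derivative at
least `-2KR` at `R`. -/
lemma neg_le_derivWithin_of_le_paraboloid {R K : ℝ} (hR : 0 < R) {u : ℝ → ℝ}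
    (hu : DifferentiableWithinAt ℝ u (Icc 0 R) R) (huR : u R = 0)
    (hle : ∀ Y ∈ Icc 0 R, u Y ≤ K * (R ^ 2 - Y ^ 2)) :
    -(2 * K * R) ≤ derivWithin u (Icc 0 R) R := by
  have hq : HasDerivAt (fun y : ℝ => K * y ^ 2) (2 * K * R) R := by
    simpa [mul_assoc, mul_left_comm] using (hasDerivAt_pow 2 R).const_mul K
  have := (hu.hasDerivWithinAt.add hq.hasDerivWithinAt).nonneg_of_le_on_left hR
    Ioo_subset_Icc_self fun z hz => by
      simp only [Pi.add_apply, huR]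
      linarith [hle z (Ioo_subset_Icc_self hz)]
  linarith

/-- Lemma 3.1: for `α > 0`, `β > 0`, and `n ≥ 1, κ ≠ 0` or `κ = 0`,
any solution `U^ε ∈ C²(Q) ∩ C¹(Q̄)` of the regularized unsteady problem satisfies
`|U^ε(T,Y)| ≤ K₁(R²−Y²) ≤ K₁R²` for `T ≥ 0`, `Y ∈ [0,R]`, and
`|U^ε_Y(T,R)| ≤ 2K₁R` for `T ≥ 0`, where
`K₁ = max{ sup_{Y∈[0,R)} |Ψ(Y)/(R²−Y²)|, b₀/2 }`. -/
theorem stmt8 (α β κ n R b₀ ε₀ ε : ℝ) (b Ψ : ℝ → ℝ) (U : ℝ → ℝ → ℝ)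
    (hα : 0 < α) (hβ : 0 < β) (hκ : 0 ≤ κ)
    (hcase : (1 ≤ n ∧ κ ≠ 0) ∨ κ = 0)
    (hR : 0 < R) (hε₀ : 0 < ε₀) (hε₀R : ε₀ < R) (hε : ε ∈ Ioc 0 ε₀)
    (hb : ContDiffOn ℝ 2 b (Icc 0 R))
    (hbb : ∀ Y ∈ Icc 0 R, 0 ≤ b Y ∧ b Y ≤ b₀)
    (hΨ : ContDiffOn ℝ 4 Ψ (Icc 0 R)) (hΨc : PsiCompat R b Ψ)
    (hreg2 : ContDiffOn ℝ 2 (fun p : ℝ × ℝ => U p.1 p.2) (Ioi 0 ×ˢ Ioo 0 R))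
    (hreg1 : ContDiffOn ℝ 1 (fun p : ℝ × ℝ => U p.1 p.2) (Ici 0 ×ˢ Icc 0 R))
    (hsol : RegUnsteadySol α κ n β R ε b Ψ U) :
    ∀ K₁, K₁ = max (sSup ((fun Y => |Ψ Y / (R ^ 2 - Y ^ 2)|) '' Ico 0 R)) (b₀ / 2) →
      (∀ T ≥ 0, ∀ Y ∈ Icc 0 R,
        |U T Y| ≤ K₁ * (R ^ 2 - Y ^ 2) ∧ K₁ * (R ^ 2 - Y ^ 2) ≤ K₁ * R ^ 2) ∧
      (∀ T ≥ 0, |pY R U T R| ≤ 2 * K₁ * R) := by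
  rintro K rfl
  set S := sSup ((fun Y => |Ψ Y / (R ^ 2 - Y ^ 2)|) '' Ico 0 R)
  set K := max S (b₀ / 2)
  obtain ⟨hpde, hbc, hic⟩ := hsol
  have hb0 := hbb 0 ⟨le_rfl, hR.le⟩
  have hbK : b₀ ≤ 2 * K := by linarith [le_max_right S (b₀ / 2)]
  have hK : 0 ≤ K := by linarith
  have hinit : ∀ Y ∈ Icc 0 R, |U 0 Y| ≤ K * (R ^ 2 - Y ^ 2) := by
    intro Y hY
    rw [hic Y hY]
    rcases hY.2.eq_or_lt with rfl | hYR
    · simp [hΨc.2.1]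
    · have hpos : 0 < R ^ 2 - Y ^ 2 := by nlinarith [hY.1]
      have h := (le_csSup (bddAbove_abs_div_paraboloid hR (hΨ.of_le (by norm_num)) hΨc.2.1)
        (mem_image_of_mem _ (show Y ∈ Ico 0 R from ⟨hY.1, hYR⟩))).trans (le_max_left S (b₀ / 2))
      simp only [abs_div, abs_of_pos hpos] at h
      exact (div_le_iff₀ hpos).1 h
  have hupper : ∀ T ≥ 0, ∀ Y ∈ Icc 0 R, U T Y ≤ K * (R ^ 2 - Y ^ 2) := fun T hT Y hY =>
    le_paraboloid_of_source_le hα hβ hκ hcase hR hε.1 hK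
      (fun y hy => (hbb y (Ioo_subset_Icc_self hy)).2.trans hbK) hreg2 hreg1 hpde hbc
      (fun y hy => (abs_le.1 (hinit y hy)).2) hT hY
  have hpT (T Y : ℝ) : pT (Ici 0) (fun t y => -U t y) T Y = -pT (Ici 0) U T Y :=
    derivWithin.fun_neg
  have hpY (T Y : ℝ) : pY R (fun t y => -U t y) T Y = -pY R U T Y := derivWithin.fun_neg
  have hpYY (T Y : ℝ) : pYY R (fun t y => -U t y) T Y = -pYY R U T Y := by
    simp only [pYY, hpY]
    exact derivWithin.fun_neg
  have hlower : ∀ T ≥ 0, ∀ Y ∈ Icc 0 R, -U T Y ≤ K * (R ^ 2 - Y ^ 2) := fun T hT Y hY =>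
    le_paraboloid_of_source_le (U := fun t y => -U t y) (f := fun y => -b y)
      hα hβ hκ hcase hR hε.1 hK
      (fun y hy => by linarith [(hbb y (Ioo_subset_Icc_self hy)).1]) hreg2.neg hreg1.neg
      (fun t ht y hy => by
        simp only [hpT, hpY, hpYY, abs_neg]
        linarith [hpde t ht y hy])
      (fun t ht => by simp [hpY, hbc t ht])
      (fun y hy => by linarith [(abs_le.1 (hinit y hy)).1]) hT hY
  refine ⟨fun T hT Y hY => ⟨abs_le.2 ⟨by linarith [hlower T hT Y hY], hupper T hT Y hY⟩, ?_⟩,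
    fun T hT => ?_⟩
  · gcongr
    linarith [sq_nonneg Y]
  · have hd : DifferentiableWithinAt ℝ (U T) (Icc 0 R) R :=
      ((hreg1.differentiableOn (by simp)) (T, R) ⟨hT, right_mem_Icc.2 hR.le⟩).comp R
        (f := fun z : ℝ => (T, z)) (by fun_prop) fun z hz => ⟨hT, hz⟩
    have h1 := neg_le_derivWithin_of_le_paraboloid hR hd (hbc T hT).2 (hupper T hT)
    have h2 := neg_le_derivWithin_of_le_paraboloid (u := fun y => -U T y) hR hd.neg
      (by simp [(hbc T hT).2]) (hlower T hT)
    rw [derivWithin.fun_neg] at h2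
    exact abs_le.2 ⟨h1, by unfold pY; linarith⟩
end
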